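/- Fix α ∈ (0,1) and the biased two-point measure ν_α on {−1,1}. Let A ⊆ {−1,1}^n, let ψ : ℝ → {−1,1} be the increasing map with ψ(u) = 1 if and only if Φ(u) ≥ 1−α (so that μ ∘ ψ^{−1} = ν_α), and let A_G = (ψ^{⊗n})^{−1}(A) ⊆ ℝ^n. Then for every ρ ∈ (0,1), VAR^G(A_G, ρ) = VAR(A, η), where η = P[W₁ < Φ^{−1}(α), W₁^ρ > Φ^{−1}(α)] / (α(1−α)) and (W₁, W₁^ρ) is a bivariate normal vector with mean zero, unit variances, and correlation √(1−ρ²). -/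

import Mathlib

open MeasureTheory ProbabilityTheory Filter Pointwise

noncomputable section

/-- The standard Gaussian measure on `ℝ`. -/
def stdGaussian : Measure ℝ := gaussianReal 0 1

/-- The `n`-fold product of the standard Gaussian measure on `ℝⁿ`. -/
def gaussianPi (n : ℕ) : Measure (Fin n → ℝ) := Measure.pi fun _ => stdGaussian

/-- Lower Minkowski content of a set `S ⊆ ℝ` w.r.t. the standard Gaussian measure. -/
def minkContent (S : Set ℝ) : ℝ :=
  Filter.liminf
    (fun r : ℝ =>
      ((stdGaussian (S + Set.Icc (-r) r)).toReal - (stdGaussian S).toReal) / r)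
    (nhdsWithin 0 (Set.Ioi 0))

/-- The restriction of `A` along the fiber of `x` in the `i`-th direction. -/
def fiber {n : ℕ} (A : Set (Fin n → ℝ)) (i : Fin n) (x : Fin n → ℝ) : Set ℝ :=
  {y : ℝ | Function.update x i y ∈ A}

/-- The geometric influence of coordinate `i` on `A`. -/
def geomInfluence {n : ℕ} (A : Set (Fin n → ℝ)) (i : Fin n) : ℝ :=
  ∫ x, minkContent (fiber A i x) ∂(gaussianPi n)

/-- A set is increasing if its indicator is nondecreasing in each coordinate. -/
def IncreasingSet {n : ℕ} (A : Set (Fin n → ℝ)) : Prop :=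
  ∀ ⦃x y : Fin n → ℝ⦄, x ≤ y → x ∈ A → y ∈ A

end


noncomputable section

/-- For a pair `p = (w, w')` of points of `ℝⁿ`, the `ρ`-noised point
`W^ρ = √(1−ρ²)·w + ρ·w'`. -/
def noised {n : ℕ} (ρ : ℝ) (p : (Fin n → ℝ) × (Fin n → ℝ)) : Fin n → ℝ :=
  fun i => Real.sqrt (1 - ρ ^ 2) * p.1 i + ρ * p.2 i

/-- `Z^G(f, ρ) = E[f(W)·f(W^ρ)]` where `W, W'` are i.i.d. standard Gaussian vectors. -/
def gaussZ {n : ℕ} (f : (Fin n → ℝ) → ℝ) (ρ : ℝ) : ℝ :=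
  ∫ p, f p.1 * f (noised ρ p) ∂((gaussianPi n).prod (gaussianPi n))

/-- `VAR^G(f, ρ) = Z^G(f, ρ) − (E f(W))²`. -/
def gaussVAR {n : ℕ} (f : (Fin n → ℝ) → ℝ) (ρ : ℝ) : ℝ :=
  gaussZ f ρ - (∫ x, f x ∂(gaussianPi n)) ^ 2

end

noncomputable section

open Classical in
/-- The biased measure `ν_α = α·δ_{1} + (1−α)·δ_{−1}` on `{−1,1}`, modelled on `Bool`
with `true ↔ 1` and `false ↔ −1`. -/
def biasedBool (α : ℝ) : Measure Bool :=
  ENNReal.ofReal α • Measure.dirac true + ENNReal.ofReal (1 - α) • Measure.dirac false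

/-- The product biased measure `ν_α^{⊗n}` on `{−1,1}ⁿ`. -/
def biasedPi (n : ℕ) (α : ℝ) : Measure (Fin n → Bool) :=
  Measure.pi fun _ => biasedBool α

/-- `VAR(B, η)` on the biased cube: `X ∼ ν_α^{⊗n}` and `X^η` is obtained from `X` by
independently resampling each coordinate from `ν_α` with probability `η`. The triple
`(X, X', R)` of the original point, the fresh resamples, and the `Bernoulli(η)` resampling
indicators is distributed according to `ν_α^{⊗n} ⊗ ν_α^{⊗n} ⊗ ν_η^{⊗n}`. -/
def cubeNoisyVar (n : ℕ) (α η : ℝ) (B : Set (Fin n → Bool)) : ℝ :=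
  (∫ z : (Fin n → Bool) × (Fin n → Bool) × (Fin n → Bool),
      B.indicator 1 z.1 * B.indicator 1 (fun i => if z.2.2 i then z.2.1 i else z.1 i)
      ∂((biasedPi n α).prod ((biasedPi n α).prod (biasedPi n η))))
    - (∫ x, B.indicator 1 x ∂(biasedPi n α)) ^ 2

/-- The standard normal distribution function `Φ`. -/
def Phi (u : ℝ) : ℝ := (stdGaussian (Set.Iic u)).toReal

/-- `P[W₁ < t, W₁^ρ > t]` where `(W₁, W₁^ρ)` is a mean-zero bivariate normal vector with
unit variances and correlation `√(1−ρ²)`, realized as `W₁^ρ = √(1−ρ²)·W₁ + ρ·W₁'` for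
independent standard Gaussians `W₁, W₁'`. -/
def crossProb (ρ t : ℝ) : ℝ :=
  ((stdGaussian.prod stdGaussian)
    {p : ℝ × ℝ | p.1 < t ∧ t < Real.sqrt (1 - ρ ^ 2) * p.1 + ρ * p.2}).toReal

open Classical in
/-- The increasing map `ψ : ℝ → {−1,1}` with `ψ(u) = 1 ↔ Φ(u) ≥ 1 − α`, pushing `μ`
forward to `ν_α`. -/
def psi (α u : ℝ) : Bool := if 1 - α ≤ Phi u then true else false

end

instance stdGaussian_isProb : IsProbabilityMeasure _root_.stdGaussian := by
  unfold _root_.stdGaussian; infer_instance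

lemma stdGaussian_singleton (x : ℝ) : _root_.stdGaussian {x} = 0 := by
  unfold _root_.stdGaussian
  have := noAtoms_gaussianReal (μ := 0) (v := 1) one_ne_zero
  exact measure_singleton x

lemma stdGaussian_map_neg : _root_.stdGaussian.map (fun x => -x) = _root_.stdGaussian := by
  unfold _root_.stdGaussian
  rw [gaussianReal_map_neg, neg_zero]

lemma biasedBool_isProb {α : ℝ} (h0 : 0 ≤ α) (h1 : α ≤ 1) :
    IsProbabilityMeasure (biasedBool α) := by
  constructor
  simp only [biasedBool, Measure.add_apply, Measure.smul_apply, measure_univ, smul_eq_mul, mul_one]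
  rw [← ENNReal.ofReal_add h0 (by linarith)]
  simp

lemma biasedBool_true {α : ℝ} (h0 : 0 ≤ α) : (biasedBool α).real {true} = α := by
  simp [biasedBool, Measure.real, h0]

lemma biasedBool_false {α : ℝ} (h1 : α ≤ 1) : (biasedBool α).real {false} = 1 - α := by
  simp [biasedBool, Measure.real, h1]

/-- A pair of bits is determined by its marginals and one cross probability. -/
lemma bool_pair_ext (P Q : Measure (Bool × Bool)) [IsProbabilityMeasure P] [IsProbabilityMeasure Q]
    (h1 : P.real {p | p.1 = true} = Q.real {p | p.1 = true})
    (h2 : P.real {p | p.2 = true} = Q.real {p | p.2 = true})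
    (h3 : P.real {(false, true)} = Q.real {(false, true)}) : P = Q := by
  have key : ∀ R : Measure (Bool × Bool), IsProbabilityMeasure R →
      R.real {p | p.1 = true} = R.real {(true, true)} + R.real {(true, false)} ∧
      R.real {p | p.2 = true} = R.real {(true, true)} + R.real {(false, true)} ∧
      1 = R.real {(true, true)} + R.real {(true, false)} + R.real {(false, true)}
        + R.real {(false, false)} := by
    intro R hR
    refine ⟨?_, ?_, ?_⟩
    · rw [← measureReal_union (by simp) (by measurability)]
      congr 1; ext ⟨a, b⟩; cases a <;> cases b <;> simp
    · rw [← measureReal_union (by simp) (by measurability)]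
      congr 1; ext ⟨a, b⟩; cases a <;> cases b <;> simp
    · rw [← measureReal_union (by simp) (by measurability),
        ← measureReal_union (by simp) (by measurability),
        ← measureReal_union (by simp) (by measurability), ← probReal_univ (μ := R)]
      congr 1; ext ⟨a, b⟩; cases a <;> cases b <;> simp
  obtain ⟨a1, a2, a3⟩ := key P inferInstance
  obtain ⟨b1, b2, b3⟩ := key Q inferInstance
  refine Measure.ext_of_singleton fun x => ?_
  rw [← measureReal_eq_measureReal_iff]
  obtain ⟨a, b⟩ := x
  cases a <;> cases b <;> linarith

/-- The noised scalar. -/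
noncomputable def zmap (ρ : ℝ) (p : ℝ × ℝ) : ℝ := Real.sqrt (1 - ρ ^ 2) * p.1 + ρ * p.2

lemma measurable_zmap (ρ : ℝ) : Measurable (zmap ρ) := by
  unfold zmap; fun_prop

lemma map_zmap {ρ : ℝ} (hρ : ρ ∈ Set.Ioo (0 : ℝ) 1) :
    (_root_.stdGaussian.prod _root_.stdGaussian).map (zmap ρ) = _root_.stdGaussian := by
  have hind : IndepFun (fun p : ℝ × ℝ => Real.sqrt (1 - ρ ^ 2) * p.1) (fun p : ℝ × ℝ => ρ * p.2)
      (_root_.stdGaussian.prod _root_.stdGaussian) :=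
    indepFun_prod (X := fun x : ℝ => Real.sqrt (1 - ρ ^ 2) * x) (Y := fun x : ℝ => ρ * x)
      (by fun_prop) (by fun_prop)
  have hX : (_root_.stdGaussian.prod _root_.stdGaussian).map (fun p : ℝ × ℝ => Real.sqrt (1 - ρ ^ 2) * p.1)
      = gaussianReal (Real.sqrt (1 - ρ ^ 2) * 0) (.mk (Real.sqrt (1 - ρ ^ 2) ^ 2) (sq_nonneg _) * 1) := by
    rw [← gaussianReal_map_const_mul]
    change Measure.map ((fun x => Real.sqrt (1 - ρ ^ 2) * x) ∘ Prod.fst) _ = _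
    rw [← Measure.map_map (by fun_prop) (by fun_prop), Measure.map_fst_prod]
    simp [_root_.stdGaussian]
  have hY : (_root_.stdGaussian.prod _root_.stdGaussian).map (fun p : ℝ × ℝ => ρ * p.2)
      = gaussianReal (ρ * 0) (.mk (ρ ^ 2) (sq_nonneg _) * 1) := by
    rw [← gaussianReal_map_const_mul]
    change Measure.map ((fun x => ρ * x) ∘ Prod.snd) _ = _
    rw [← Measure.map_map (by fun_prop) (by fun_prop), Measure.map_snd_prod]
    simp [_root_.stdGaussian]
  have h := gaussianReal_add_gaussianReal_of_indepFun hind hX hY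
  change Measure.map (zmap ρ) _ = _ at h
  rw [h, _root_.stdGaussian]
  have h1 : 0 ≤ 1 - ρ ^ 2 := by nlinarith [hρ.1, hρ.2]
  congr 1
  · simp
  · ext; simp [Real.sq_sqrt h1]

lemma real_zmap {ρ : ℝ} (hρ : ρ ∈ Set.Ioo (0 : ℝ) 1) {S : Set ℝ} (hS : MeasurableSet S) :
    (_root_.stdGaussian.prod _root_.stdGaussian).real (zmap ρ ⁻¹' S) = _root_.stdGaussian.real S := by
  rw [← map_measureReal_apply (measurable_zmap ρ) hS, map_zmap hρ]

lemma real_fst {S : Set ℝ} :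
    (_root_.stdGaussian.prod _root_.stdGaussian).real (Prod.fst ⁻¹' S) = _root_.stdGaussian.real S := by
  rw [← Set.prod_univ, measureReal_prod_prod]; simp

lemma real_Iio (t : ℝ) : _root_.stdGaussian.real (Set.Iio t) = Phi t := by
  unfold Phi Measure.real
  rw [← Set.Iio_union_right, measure_congr]
  exact (union_ae_eq_left_of_ae_eq_empty (ae_eq_empty.mpr (stdGaussian_singleton t))).symm

lemma real_Iic (t : ℝ) : _root_.stdGaussian.real (Set.Iic t) = Phi t := rfl

lemma real_Ici (t : ℝ) : _root_.stdGaussian.real (Set.Ici t) = 1 - Phi t := by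
  rw [← Set.compl_Iio, probReal_compl_eq_one_sub measurableSet_Iio, real_Iio]

lemma real_Ioi (t : ℝ) : _root_.stdGaussian.real (Set.Ioi t) = 1 - Phi t := by
  rw [← Set.compl_Iic, probReal_compl_eq_one_sub measurableSet_Iic, real_Iic]

lemma Phi_neg (t : ℝ) : Phi (-t) = 1 - Phi t := by
  rw [← real_Ici, ← real_Iic]
  conv_lhs => rw [← stdGaussian_map_neg]
  rw [map_measureReal_apply (by fun_prop) measurableSet_Iic]
  congr 1; ext x; simp

lemma Phi_strictMono : StrictMono Phi := by
  intro a b hab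
  rw [← real_Iic, ← real_Iic, ← Set.Iic_union_Ioc_eq_Iic hab.le,
    measureReal_union (by
      rw [Set.disjoint_left]; intro x hx hx2; exact absurd hx2.1 (not_lt.mpr hx)) measurableSet_Ioc]
  have : _root_.stdGaussian (Set.Ioc a b) ≠ 0 := by
    intro h
    have := gaussianReal_absolutelyContinuous' 0 (v := 1) one_ne_zero h
    simp at this
    linarith
  have : 0 < _root_.stdGaussian.real (Set.Ioc a b) :=
    ENNReal.toReal_pos this (measure_ne_top _ _)
  linarith

lemma psi_iff {α t : ℝ} (ht : Phi t = α) (u : ℝ) : psi α u = true ↔ -t ≤ u := by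
  unfold psi
  rw [← ht, ← Phi_neg]
  simp [Phi_strictMono.le_iff_le]

lemma measurable_psi {α t : ℝ} (ht : Phi t = α) : Measurable (psi α) := by
  refine measurable_to_bool ?_
  have : psi α ⁻¹' {true} = Set.Ici (-t) := by
    ext u; simpa using psi_iff ht u
  rw [this]; exact measurableSet_Ici

/-- Positive correlation. -/
lemma crossProb_le {α t ρ : ℝ} (hα : α ∈ Set.Ioo (0 : ℝ) 1) (hρ : ρ ∈ Set.Ioo (0 : ℝ) 1)
    (ht : Phi t = α) : crossProb ρ t ≤ α * (1 - α) := by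
  set c := Real.sqrt (1 - ρ ^ 2) with hc
  have hc0 : 0 ≤ c := Real.sqrt_nonneg _
  let T : Set ℝ := {y | t < c * t + ρ * y}
  let P := _root_.stdGaussian.prod _root_.stdGaussian
  have h1 : crossProb ρ t ≤ α * _root_.stdGaussian.real T := by
    rw [← ht, ← real_Iio, ← measureReal_prod_prod]
    refine measureReal_mono ?_
    rintro ⟨x, y⟩ ⟨hx, hy⟩
    refine ⟨hx, ?_⟩
    change t < c * t + ρ * y
    simp only at hx hy
    nlinarith
  let S2 : Set (ℝ × ℝ) := {p | t ≤ p.1 ∧ t < c * p.1 + ρ * p.2}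
  have h2 : (1 - α) * _root_.stdGaussian.real T ≤ P.real S2 := by
    rw [← ht, ← real_Ici, ← measureReal_prod_prod]
    refine measureReal_mono ?_
    rintro ⟨x, y⟩ ⟨hx, hy⟩
    refine ⟨hx, ?_⟩
    change t < c * t + ρ * y at hy
    change t ≤ x at hx
    change t < c * x + ρ * y
    nlinarith
  have h3 : crossProb ρ t + P.real S2 = 1 - α := by
    rw [← ht, ← real_Ioi, ← real_zmap hρ measurableSet_Ioi]
    change P.real _ + P.real S2 = _
    rw [← measureReal_union]
    · congr 1
      ext ⟨x, y⟩
      simp only [S2, zmap, Set.mem_union, Set.mem_ofPred_eq, Set.mem_preimage, Set.mem_Ioi]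
      constructor
      · rintro (h | h) <;> exact h.2
      · intro h
        rcases lt_or_ge x t with hx | hx
        · exact Or.inl ⟨hx, h⟩
        · exact Or.inr ⟨hx, h⟩
    · rw [Set.disjoint_left]
      rintro p hp hp2
      exact absurd hp.1 (not_lt.mpr hp2.1)
    · exact (measurableSet_le measurable_const measurable_fst).inter
        (measurableSet_lt measurable_const (measurable_zmap ρ))
  obtain ⟨ha, hb⟩ := hα
  nlinarith

/-- Reflecting the threshold. -/
lemma cross_reflect {t ρ : ℝ} (hρ : ρ ∈ Set.Ioo (0 : ℝ) 1) :
    (_root_.stdGaussian.prod _root_.stdGaussian).real {p | p.1 < -t ∧ -t ≤ zmap ρ p} = crossProb ρ t := by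
  let P := _root_.stdGaussian.prod _root_.stdGaussian
  have hneg : P.map (Prod.map (fun x : ℝ => -x) (fun x : ℝ => -x)) = P := by
    rw [← Measure.map_prod_map _ _ (by fun_prop) (by fun_prop), stdGaussian_map_neg]
  have mz := measurable_zmap ρ
  have hm : MeasurableSet {p : ℝ × ℝ | p.1 < -t ∧ -t ≤ zmap ρ p} :=
    (measurableSet_lt measurable_fst measurable_const).inter
        (measurableSet_le measurable_const mz)
  have e1 : P.real {p | p.1 < -t ∧ -t ≤ zmap ρ p} = P.real {p | t < p.1 ∧ zmap ρ p ≤ t} := by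
    conv_lhs => rw [← hneg]
    rw [map_measureReal_apply (by fun_prop) hm]
    congr 1
    ext ⟨x, y⟩
    simp only [zmap, Set.mem_preimage, Prod.map, Set.mem_ofPred_eq]
    constructor <;> rintro ⟨h, h'⟩ <;> constructor <;> linarith
  let S : Set (ℝ × ℝ) := {p | p.1 ≤ t ∧ zmap ρ p ≤ t}
  have mS : MeasurableSet S := (measurableSet_le measurable_fst measurable_const).inter
        (measurableSet_le mz measurable_const)
  have e2 : P.real {p | t < p.1 ∧ zmap ρ p ≤ t} + P.real S = Phi t := by
    rw [← real_Iic, ← real_zmap hρ measurableSet_Iic, ← measureReal_union _ mS]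
    · congr 1
      ext p
      simp only [S, Set.mem_union, Set.mem_ofPred_eq, Set.mem_preimage, Set.mem_Iic]
      have := lt_or_ge t p.1
      tauto
    · rw [Set.disjoint_left]
      rintro p hp hp2
      exact absurd hp.1 (not_lt.mpr hp2.1)
  have e3 : P.real {p | p.1 ≤ t ∧ t < zmap ρ p} + P.real S = Phi t := by
    rw [← real_Iic, ← real_fst, ← measureReal_union _ mS]
    · congr 1
      ext p
      simp only [S, Set.mem_union, Set.mem_ofPred_eq, Set.mem_preimage, Set.mem_Iic]
      have := lt_or_ge t (zmap ρ p)
      tauto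
    · rw [Set.disjoint_left]
      rintro p hp hp2
      exact absurd hp.2 (not_lt.mpr hp2.2)
  have e4 : P.real {p | p.1 ≤ t ∧ t < zmap ρ p} = crossProb ρ t := by
    change _ = P.real {p | p.1 < t ∧ t < zmap ρ p}
    refine measureReal_congr ?_
    have h0 : P (Prod.fst ⁻¹' {t}) = 0 := by
      rw [← Set.prod_univ, Measure.prod_prod, stdGaussian_singleton, zero_mul]
    have h1 : ∀ᵐ p ∂P, p.1 ≠ t := by
      rw [ae_iff]; simp only [not_not, ne_eq]; exact h0
    filter_upwards [h1] with p hp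
    apply propext
    change (p.1 ≤ t ∧ _) ↔ (p.1 < t ∧ _)
    have := lt_iff_le_and_ne (a := p.1) (b := t)
    tauto
  change P.real _ = _
  linarith

lemma map_psi {α t : ℝ} (hα : α ∈ Set.Ioo (0 : ℝ) 1) (ht : Phi t = α) :
    _root_.stdGaussian.map (psi α) = biasedBool α := by
  have := biasedBool_isProb hα.1.le hα.2.le
  have : IsProbabilityMeasure (_root_.stdGaussian.map (psi α)) :=
    Measure.isProbabilityMeasure_map (measurable_psi ht).aemeasurable
  have hT : (_root_.stdGaussian.map (psi α)).real {true} = (biasedBool α).real {true} := by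
    rw [biasedBool_true hα.1.le, map_measureReal_apply (measurable_psi ht) (by measurability)]
    have : psi α ⁻¹' {true} = Set.Ici (-t) := by
      ext u; simpa using psi_iff ht u
    rw [this, real_Ici, Phi_neg, ht]; ring
  have hc : ({false} : Set Bool) = {true}ᶜ := by ext b; cases b <;> simp
  refine Measure.ext_of_singleton fun b => ?_
  rw [← measureReal_eq_measureReal_iff]
  cases b
  · rw [hc, probReal_compl_eq_one_sub (by measurability),
      probReal_compl_eq_one_sub (by measurability), hT]
  · exact hT

/-- One-coordinate joint law on the Gaussian side. -/
noncomputable def gpair (α ρ : ℝ) (p : ℝ × ℝ) : Bool × Bool := (psi α p.1, psi α (zmap ρ p))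

/-- One-coordinate joint law on the cube side. -/
noncomputable def cpair (z : Bool × Bool × Bool) : Bool × Bool := (z.1, if z.2.2 then z.2.1 else z.1)

lemma measurable_gpair {α t : ℝ} (ρ : ℝ) (ht : Phi t = α) : Measurable (gpair α ρ) :=
  ((measurable_psi ht).comp measurable_fst).prodMk ((measurable_psi ht).comp (measurable_zmap ρ))

lemma measurable_cpair : Measurable cpair := measurable_of_countable _

lemma eta_mem {α t ρ : ℝ} (hα : α ∈ Set.Ioo (0 : ℝ) 1) (hρ : ρ ∈ Set.Ioo (0 : ℝ) 1)
    (ht : Phi t = α) : 0 ≤ crossProb ρ t / (α * (1 - α)) ∧ crossProb ρ t / (α * (1 - α)) ≤ 1 := by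
  have h : 0 < α * (1 - α) := mul_pos hα.1 (by linarith [hα.2])
  refine ⟨div_nonneg ENNReal.toReal_nonneg h.le, ?_⟩
  rw [div_le_one h]
  exact crossProb_le hα hρ ht

lemma pair_law {α t ρ : ℝ} (hα : α ∈ Set.Ioo (0 : ℝ) 1) (hρ : ρ ∈ Set.Ioo (0 : ℝ) 1)
    (ht : Phi t = α) :
    (_root_.stdGaussian.prod _root_.stdGaussian).map (gpair α ρ) =
      ((biasedBool α).prod ((biasedBool α).prod
        (biasedBool (crossProb ρ t / (α * (1 - α)))))).map cpair := by
  obtain ⟨he0, he1⟩ := eta_mem hα hρ ht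
  have hpos : 0 < α * (1 - α) := mul_pos hα.1 (by linarith [hα.2])
  have hη : crossProb ρ t = (1 - α) * (α * (crossProb ρ t / (α * (1 - α)))) := by
    rw [← mul_assoc, mul_comm (1 - α), mul_div_cancel₀ _ hpos.ne']
  set η := crossProb ρ t / (α * (1 - α)) with hηd
  have := biasedBool_isProb hα.1.le hα.2.le
  have := biasedBool_isProb he0 he1
  have : IsProbabilityMeasure ((_root_.stdGaussian.prod _root_.stdGaussian).map (gpair α ρ)) :=
    Measure.isProbabilityMeasure_map (measurable_gpair ρ ht).aemeasurable
  have : IsProbabilityMeasure (((biasedBool α).prod ((biasedBool α).prod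
        (biasedBool η))).map cpair) :=
    Measure.isProbabilityMeasure_map measurable_cpair.aemeasurable
  refine bool_pair_ext _ _ ?_ ?_ ?_
  · rw [map_measureReal_apply (measurable_gpair ρ ht) (Set.toFinite _).measurableSet,
      map_measureReal_apply measurable_cpair (Set.toFinite _).measurableSet]
    have e1 : gpair α ρ ⁻¹' {p | p.1 = true} = Prod.fst ⁻¹' (Set.Ici (-t)) := by
      ext p; simpa [gpair] using psi_iff ht p.1
    have e2 : cpair ⁻¹' {p | p.1 = true} = {true} ×ˢ Set.univ := by
      ext ⟨a, b, c⟩; simp [cpair]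
    rw [e1, e2, real_fst, real_Ici, Phi_neg, ht, measureReal_prod_prod, biasedBool_true hα.1.le]
    simp
  · rw [map_measureReal_apply (measurable_gpair ρ ht) (Set.toFinite _).measurableSet,
      map_measureReal_apply measurable_cpair (Set.toFinite _).measurableSet]
    have e1 : gpair α ρ ⁻¹' {p | p.2 = true} = zmap ρ ⁻¹' (Set.Ici (-t)) := by
      ext p; simpa [gpair] using psi_iff ht (zmap ρ p)
    have e2 : cpair ⁻¹' {p | p.2 = true} =
        ({true} ×ˢ (Set.univ ×ˢ {false})) ∪ (Set.univ ×ˢ ({true} ×ˢ {true})) := by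
      ext ⟨a, b, c⟩; cases a <;> cases b <;> cases c <;> simp [cpair]
    rw [e1, e2, real_zmap hρ measurableSet_Ici, real_Ici, Phi_neg, ht, measureReal_union]
    · simp only [measureReal_prod_prod, biasedBool_true hα.1.le, biasedBool_true he0,
        biasedBool_false he1, probReal_univ]
      ring
    · rw [Set.disjoint_left]
      rintro ⟨a, b, c⟩ h h'
      have h1 : c = false := h.2.2
      have h2 : c = true := h'.2.2
      rw [h1] at h2
      exact Bool.noConfusion h2
    · exact (Set.toFinite _).measurableSet
  · rw [map_measureReal_apply (measurable_gpair ρ ht) (Set.toFinite _).measurableSet,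
      map_measureReal_apply measurable_cpair (Set.toFinite _).measurableSet]
    have e1 : gpair α ρ ⁻¹' {(false, true)} = {p | p.1 < -t ∧ -t ≤ zmap ρ p} := by
      ext p
      have h1 := psi_iff ht p.1
      have h2 := psi_iff ht (zmap ρ p)
      simp only [gpair, Set.mem_preimage, Set.mem_singleton_iff, Prod.mk.injEq, Set.mem_ofPred_eq, h2]
      rw [← not_le, ← h1]
      simp
    have e2 : cpair ⁻¹' {(false, true)} = {false} ×ˢ ({true} ×ˢ {true}) := by
      ext ⟨a, b, c⟩; cases a <;> cases b <;> cases c <;> simp [cpair]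
    rw [e1, e2, cross_reflect hρ]
    simp only [measureReal_prod_prod, biasedBool_true hα.1.le, biasedBool_true he0,
        biasedBool_false hα.2.le]
    exact hη

lemma pi_prod_map {X Y : Type*} [MeasurableSpace X] [MeasurableSpace Y] (n : ℕ)
    (μ : Measure X) (ν : Measure Y) [SigmaFinite μ] [SigmaFinite ν] :
    ((Measure.pi fun _ : Fin n => μ).prod (Measure.pi fun _ : Fin n => ν)).map
      (fun p i => (p.1 i, p.2 i)) = Measure.pi fun _ : Fin n => μ.prod ν :=
  ((measurePreserving_arrowProdEquivProdArrow X Y (Fin n) (fun _ => μ) (fun _ => ν)).symm).map_eq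

/-- **Lemma (noise correspondence between the biased cube and Gaussian space).**
Fix `α ∈ (0,1)`, let `A ⊆ {−1,1}ⁿ` and let `A_G = (ψ^{⊗n})⁻¹(A)`. Then for every
`ρ ∈ (0,1)`, `VAR^G(A_G, ρ) = VAR(A, η)` with
`η = P[W₁ < Φ⁻¹(α), W₁^ρ > Φ⁻¹(α)] / (α(1−α))`. -/
theorem biased_cube_gaussian_noise_correspondence
    (n : ℕ) (α : ℝ) (hα : α ∈ Set.Ioo (0 : ℝ) 1) (A : Set (Fin n → Bool))
    (ρ : ℝ) (hρ : ρ ∈ Set.Ioo (0 : ℝ) 1)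
    (t : ℝ) (ht : Phi t = α) :
    gaussVAR (Set.indicator {x : Fin n → ℝ | (fun i => psi α (x i)) ∈ A} 1) ρ =
      cubeNoisyVar n α (crossProb ρ t / (α * (1 - α))) A := by
  obtain ⟨he0, he1⟩ := eta_mem hα hρ ht
  have hlaw := pair_law hα hρ ht
  set η := crossProb ρ t / (α * (1 - α)) with hη
  have := biasedBool_isProb hα.1.le hα.2.le
  have := biasedBool_isProb he0 he1
  have mpsi := measurable_psi ht
  have mg := measurable_gpair ρ ht
  have mpsin : Measurable (fun (x : Fin n → ℝ) i => psi α (x i)) := by fun_prop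
  have : IsProbabilityMeasure ((_root_.stdGaussian.prod _root_.stdGaussian).map (gpair α ρ)) :=
    Measure.isProbabilityMeasure_map mg.aemeasurable
  have : IsProbabilityMeasure (((biasedBool α).prod ((biasedBool α).prod
        (biasedBool η))).map cpair) :=
    Measure.isProbabilityMeasure_map measurable_cpair.aemeasurable
  have : IsProbabilityMeasure (_root_.stdGaussian.map (psi α)) :=
    Measure.isProbabilityMeasure_map mpsi.aemeasurable
  unfold gaussVAR cubeNoisyVar gaussZ
  congr 1
  · let F : (Fin n → Bool × Bool) → ℝ := fun w =>
      A.indicator 1 (fun i => (w i).1) * A.indicator 1 (fun i => (w i).2)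
    have hF : Measurable F := measurable_of_countable _
    have hG : ((gaussianPi n).prod (gaussianPi n)).map
        (fun p i => gpair α ρ (p.1 i, p.2 i)) =
        Measure.pi fun _ : Fin n => (_root_.stdGaussian.prod _root_.stdGaussian).map (gpair α ρ) := by
      rw [← Measure.pi_map_pi (fun _ => mg.aemeasurable), ← pi_prod_map,
        Measure.map_map (by fun_prop) (by fun_prop)]
      rfl
    have hC : ((biasedPi n α).prod ((biasedPi n α).prod (biasedPi n η))).map
        (fun z i => cpair (z.1 i, z.2.1 i, z.2.2 i)) =
        Measure.pi fun _ : Fin n => ((biasedBool α).prod ((biasedBool α).prod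
          (biasedBool η))).map cpair := by
      rw [← Measure.pi_map_pi (fun _ => measurable_cpair.aemeasurable), ← pi_prod_map,
        ← pi_prod_map, Measure.map_map (measurable_of_countable _) (by fun_prop)]
      have : (Measure.pi fun _ : Fin n => biasedBool α) =
        (Measure.pi fun _ : Fin n => biasedBool α).map id := by simp
      conv_rhs => rw [this]
      rw [Measure.map_prod_map _ _ (by fun_prop) (by fun_prop),
        Measure.map_map (measurable_of_countable _) (by fun_prop)]
      simp only [Measure.map_id]
      rfl
    have i1 : ∫ p, F (fun i => gpair α ρ (p.1 i, p.2 i)) ∂((gaussianPi n).prod (gaussianPi n))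
        = ∫ w, F w ∂(Measure.pi fun _ : Fin n =>
          (_root_.stdGaussian.prod _root_.stdGaussian).map (gpair α ρ)) := by
      rw [← hG, integral_map (by fun_prop) hF.aestronglyMeasurable]
    have i2 : ∫ z, F (fun i => cpair (z.1 i, z.2.1 i, z.2.2 i))
          ∂((biasedPi n α).prod ((biasedPi n α).prod (biasedPi n η)))
        = ∫ w, F w ∂(Measure.pi fun _ : Fin n => ((biasedBool α).prod ((biasedBool α).prod
          (biasedBool η))).map cpair) := by
      rw [← hC, integral_map (measurable_of_countable _).aemeasurable hF.aestronglyMeasurable]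
    rw [hlaw, ← i2] at i1
    exact i1
  · congr 1
    have hm : (gaussianPi n).map (fun x i => psi α (x i)) = biasedPi n α := by
      unfold gaussianPi biasedPi
      rw [Measure.pi_map_pi (fun _ => mpsi.aemeasurable), map_psi hα ht]
    rw [← hm, integral_map mpsin.aemeasurable (measurable_of_countable _).aestronglyMeasurable]
    rfl
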